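/- Let k be a commutative ring, and let π_A: A → R and π: R → R₀ be surjective homomorphisms of commutative k-algebras with I = ker(π) satisfying I² = 0, and J₀ = ker(π ∘ π_A). Let κ: J₀/J₀² → I be the map induced by π_A, and let θ: I_{Δ_A} ⊗_{A⊗_kA} (R₀⊗_kR₀) → I_{Δ_R} ⊗_{R⊗_kR} (R₀⊗_kR₀) be the map induced by π_A⊗π_A: A⊗_kA → R⊗_kR (which carries I_{Δ_A} into I_{Δ_R}). Then the following ladder commutes: the top row is the four-term sequence J₀/J₀² → I_{Δ_A} ⊗_{A⊗_kA} (R₀⊗_kR₀) → R₀⊗_kR₀ → R₀ associated to the surjection A → R₀ (first map: class of x ↦ (1⊗x − x⊗1)⊗1; second map induced by inclusion and quotient; third map: multiplication), the bottom row is the four-term sequence I → I_{Δ_R} ⊗_{R⊗_kR} (R₀⊗_kR₀) → R₀⊗_kR₀ → R₀ associated to the surjection R → R₀ (with I = I/I² since I² = 0, first map: x ↦ (1⊗x − x⊗1)⊗1), and the vertical maps are κ, θ, the identity of R₀⊗_kR₀, and the identity of R₀. Moreover, if A, R and R₀ are flat as k-modules, both rows are exact, with the left-hand maps injective. -/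

import Mathlib

/-!
STATEMENT 13: For surjections `π_A : A → R`, `π : R → R₀` of commutative `k`-algebras
with `I = ker π`, `I² = 0`, `J₀ = ker (π ∘ π_A)`, the ladder comparing the four-term
sequences `J₀/J₀² → I_{Δ_A} ⊗_{A⊗A} (R₀⊗R₀) → R₀⊗R₀ → R₀` (for the surjection
`A → R₀`) and `I → I_{Δ_R} ⊗_{R⊗R} (R₀⊗R₀) → R₀⊗R₀ → R₀` (for the surjection
`R → R₀`), with vertical maps `κ`, `θ`, `id`, `id`, commutes; and if `A`, `R`, `R₀`
are flat over `k`, both rows are exact with the left-hand maps injective.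
The first maps of the rows are encoded by the functions `deltaA : J₀ → I_{Δ_A} ⊗ (R₀⊗R₀)`
and `deltaR : I → I_{Δ_R} ⊗ (R₀⊗R₀)`, `x ↦ (1⊗x − x⊗1) ⊗ 1`, and `κ` by `x ↦ π_A x`.
-/

open TensorProduct

noncomputable section

variable (k A R R₀ : Type) [CommRing k] [CommRing A] [CommRing R] [CommRing R₀]
  [Algebra k A] [Algebra k R] [Algebra k R₀]

section TopRow

variable (πA : A →ₐ[k] R) (π : R →ₐ[k] R₀) [Module (A ⊗[k] A) (R₀ ⊗[k] R₀)]

/-- The map `J₀ → I_{Δ_A} ⊗_{A⊗A} (R₀ ⊗[k] R₀)`, `x ↦ (1 ⊗ x − x ⊗ 1) ⊗ 1`, inducing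
the first map of the top row on `J₀/J₀²`. -/
def deltaA (x : RingHom.ker (π.comp πA)) :
    (KaehlerDifferential.ideal k A) ⊗[A ⊗[k] A] (R₀ ⊗[k] R₀) :=
  (⟨(1 : A) ⊗ₜ[k] (x : A) - (x : A) ⊗ₜ[k] (1 : A),
      KaehlerDifferential.one_smul_sub_smul_one_mem_ideal k (x : A)⟩ :
    KaehlerDifferential.ideal k A) ⊗ₜ[A ⊗[k] A] (1 : R₀ ⊗[k] R₀)

/-- The second map of the top row, `I_{Δ_A} ⊗_{A⊗A} (R₀⊗R₀) → R₀⊗R₀`, induced by the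
inclusion `I_{Δ_A} ⊆ A ⊗[k] A`. -/
def fA : (KaehlerDifferential.ideal k A) ⊗[A ⊗[k] A] (R₀ ⊗[k] R₀) →ₗ[A ⊗[k] A]
    R₀ ⊗[k] R₀ :=
  TensorProduct.lift
    ((LinearMap.lsmul (A ⊗[k] A) (R₀ ⊗[k] R₀)).comp
      (Submodule.subtype (KaehlerDifferential.ideal k A)))

end TopRow

section BottomRow

variable (π : R →ₐ[k] R₀) [Module (R ⊗[k] R) (R₀ ⊗[k] R₀)]

/-- The map `I → I_{Δ_R} ⊗_{R⊗R} (R₀ ⊗[k] R₀)`, `x ↦ (1 ⊗ x − x ⊗ 1) ⊗ 1`, the first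
map of the bottom row (here `I = I/I²` since `I² = 0`). -/
def deltaR (x : RingHom.ker π) :
    (KaehlerDifferential.ideal k R) ⊗[R ⊗[k] R] (R₀ ⊗[k] R₀) :=
  (⟨(1 : R) ⊗ₜ[k] (x : R) - (x : R) ⊗ₜ[k] (1 : R),
      KaehlerDifferential.one_smul_sub_smul_one_mem_ideal k (x : R)⟩ :
    KaehlerDifferential.ideal k R) ⊗ₜ[R ⊗[k] R] (1 : R₀ ⊗[k] R₀)

/-- The second map of the bottom row, `I_{Δ_R} ⊗_{R⊗R} (R₀⊗R₀) → R₀⊗R₀`, induced by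
the inclusion `I_{Δ_R} ⊆ R ⊗[k] R`. -/
def fR : (KaehlerDifferential.ideal k R) ⊗[R ⊗[k] R] (R₀ ⊗[k] R₀) →ₗ[R ⊗[k] R]
    R₀ ⊗[k] R₀ :=
  TensorProduct.lift
    ((LinearMap.lsmul (R ⊗[k] R) (R₀ ⊗[k] R₀)).comp
      (Submodule.subtype (KaehlerDifferential.ideal k R)))

end BottomRow

/-- The multiplication map `μ : R₀ ⊗[k] R₀ → R₀` (the common third map of both rows). -/
abbrev muR0 : R₀ ⊗[k] R₀ →ₐ[k] R₀ := Algebra.TensorProduct.lmul' k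

section Row

open KaehlerDifferential

variable {k A C : Type} [CommRing k] [CommRing A] [CommRing C] [Algebra k A] [Algebra k C]

instance isScalarTower_quotient_cotangent (J : Ideal A) :
    IsScalarTower k (A ⧸ J) J.Cotangent :=
  IsScalarTower.of_algebraMap_smul fun r m => by
    rw [IsScalarTower.algebraMap_apply k A (A ⧸ J), algebraMap_smul, algebraMap_smul]

/-- For a surjection `φ : A → C`, the `k`-linear map `C ⊗ ker φ → ker φ / (ker φ)²`
given by the action of `C` on the conormal module. -/
def conormalAction (φ : A →ₐ[k] C) (hφ : Function.Surjective φ) :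
    C ⊗[k] (RingHom.ker φ) →ₗ[k] (RingHom.ker φ).Cotangent :=
  TensorProduct.lift (LinearMap.mk₂ k
    (fun c x => (Ideal.quotientKerAlgEquivOfSurjective hφ).symm c •
      (RingHom.ker φ).toCotangent x)
    (fun c d x => by rw [map_add, add_smul])
    (fun r c x => by rw [map_smul, smul_assoc])
    (fun c x y => by rw [map_add, smul_add])
    (fun r c x => by
      rw [LinearMap.map_smul_of_tower, ← algebraMap_smul (A ⧸ RingHom.ker φ) r,
        ← algebraMap_smul (A ⧸ RingHom.ker φ) r, smul_comm]))

lemma conormalAction_tmul (φ : A →ₐ[k] C) (hφ : Function.Surjective φ) (a : A)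
    (x : RingHom.ker φ) :
    conormalAction φ hφ (φ a ⊗ₜ x) = (RingHom.ker φ).toCotangent (a • x) := by
  have h : (Ideal.quotientKerAlgEquivOfSurjective hφ).symm (φ a) =
      Ideal.Quotient.mk (RingHom.ker φ) a := by
    rw [AlgEquiv.symm_apply_eq]
    rfl
  simp only [conormalAction, TensorProduct.lift.tmul, LinearMap.mk₂_apply, h, map_smul]
  rfl

lemma mul_tmul_mem_ideal_mul (φ : A →ₐ[k] C) {x : A} (hx : x ∈ RingHom.ker φ)
    {q : A ⊗[k] A} (hq : q ∈ ideal k A) :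
    (x ⊗ₜ[k] (1 : A)) * q ∈
      RingHom.ker (Algebra.TensorProduct.map φ φ) * ideal k A := by
  refine Ideal.mul_mem_mul ?_ hq
  rw [RingHom.mem_ker] at hx ⊢
  simp [hx]

lemma tmul_mul_mem_ideal_mul (φ : A →ₐ[k] C) {x : A} (hx : x ∈ RingHom.ker φ)
    {q : A ⊗[k] A} (hq : q ∈ ideal k A) :
    ((1 : A) ⊗ₜ[k] x) * q ∈
      RingHom.ker (Algebra.TensorProduct.map φ φ) * ideal k A := by
  refine Ideal.mul_mem_mul ?_ hq
  rw [RingHom.mem_ker] at hx ⊢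
  simp [hx]

/-- Modulo `ker (φ ⊗ φ) * I_Δ`, every element of `ker (φ ⊗ φ)` has the form
`y ⊗ 1 + 1 ⊗ x` with `x, y ∈ ker φ`. -/
lemma exists_sub_mem_ideal_mul (φ : A →ₐ[k] C) (hφ : Function.Surjective φ)
    (p : A ⊗[k] A) (hp : p ∈ RingHom.ker (Algebra.TensorProduct.map φ φ)) :
    ∃ x ∈ RingHom.ker φ, ∃ y ∈ RingHom.ker φ, p - (y ⊗ₜ 1 + 1 ⊗ₜ x) ∈
      RingHom.ker (Algebra.TensorProduct.map φ φ) * ideal k A := by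
  rw [Algebra.TensorProduct.map_ker _ _ hφ hφ] at hp
  obtain ⟨u, hu, v, hv, rfl⟩ := Submodule.mem_sup.1 hp
  have h1 : ∃ y ∈ RingHom.ker φ, u - y ⊗ₜ 1 ∈
      RingHom.ker (Algebra.TensorProduct.map φ φ) * ideal k A := by
    clear hp
    refine Submodule.span_induction ?_ ⟨0, zero_mem _, by simp⟩ ?_ ?_ hu
    · rintro _ ⟨y, hy, rfl⟩
      exact ⟨y, hy, by simp⟩
    · rintro _ _ - - ⟨y, hy, h⟩ ⟨z, hz, h'⟩
      refine ⟨y + z, add_mem hy hz, ?_⟩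
      convert add_mem h h' using 1
      rw [TensorProduct.add_tmul]; ring
    · rintro q _ - ⟨y, hy, h⟩
      refine ⟨Algebra.TensorProduct.lmul' k q * y, Ideal.mul_mem_left _ _ hy, ?_⟩
      have hq : q - Algebra.TensorProduct.lmul' k q ⊗ₜ 1 ∈ ideal k A := by
        rw [KaehlerDifferential.ideal, RingHom.mem_ker]; simp
      convert add_mem (Ideal.mul_mem_left _ q h) (mul_tmul_mem_ideal_mul φ hy hq) using 1
      have : (Algebra.TensorProduct.lmul' k q * y) ⊗ₜ[k] (1 : A) =
          (Algebra.TensorProduct.lmul' k q ⊗ₜ[k] (1 : A)) * (y ⊗ₜ[k] (1 : A)) := by simp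
      rw [this, smul_eq_mul]; ring
  have h2 : ∃ x ∈ RingHom.ker φ, v - 1 ⊗ₜ x ∈
      RingHom.ker (Algebra.TensorProduct.map φ φ) * ideal k A := by
    clear hp
    refine Submodule.span_induction ?_ ⟨0, zero_mem _, by simp⟩ ?_ ?_ hv
    · rintro _ ⟨y, hy, rfl⟩
      exact ⟨y, hy, by simp⟩
    · rintro _ _ - - ⟨y, hy, h⟩ ⟨z, hz, h'⟩
      refine ⟨y + z, add_mem hy hz, ?_⟩
      convert add_mem h h' using 1
      rw [TensorProduct.tmul_add]; ring
    · rintro q _ - ⟨y, hy, h⟩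
      refine ⟨Algebra.TensorProduct.lmul' k q * y, Ideal.mul_mem_left _ _ hy, ?_⟩
      have hq : q - 1 ⊗ₜ Algebra.TensorProduct.lmul' k q ∈ ideal k A := by
        rw [KaehlerDifferential.ideal, RingHom.mem_ker]; simp
      convert add_mem (Ideal.mul_mem_left _ q h) (tmul_mul_mem_ideal_mul φ hy hq) using 1
      have : (1 : A) ⊗ₜ[k] (Algebra.TensorProduct.lmul' k q * y) =
          ((1 : A) ⊗ₜ[k] Algebra.TensorProduct.lmul' k q) * ((1 : A) ⊗ₜ[k] y) := by simp
      rw [this, smul_eq_mul]; ring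
  obtain ⟨y, hy, h1⟩ := h1
  obtain ⟨x, hx, h2⟩ := h2
  refine ⟨x, hx, y, hy, ?_⟩
  convert add_mem h1 h2 using 1
  ring

/-- The image in `C ⊗ A` of an element of `ker (φ ⊗ φ) * I_Δ` lifts to an element of
`C ⊗ ker φ` acting trivially on the conormal module. -/
lemma exists_conormalAction_eq_zero (φ : A →ₐ[k] C) (hφ : Function.Surjective φ)
    (p : A ⊗[k] A)
    (hp : p ∈ RingHom.ker (Algebra.TensorProduct.map φ φ) * ideal k A) :
    ∃ w : C ⊗[k] RingHom.ker φ,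
      ((RingHom.ker φ).subtype.restrictScalars k).lTensor C w =
        Algebra.TensorProduct.map φ (AlgHom.id k A) p ∧
      conormalAction φ hφ w = 0 := by
  have key : ∀ (x : RingHom.ker φ) (q : A ⊗[k] A), ∃ w : C ⊗[k] RingHom.ker φ,
      ((RingHom.ker φ).subtype.restrictScalars k).lTensor C w =
        Algebra.TensorProduct.map φ (AlgHom.id k A) (q * (1 ⊗ₜ (x : A))) ∧
      conormalAction φ hφ w =
        (RingHom.ker φ).toCotangent (Algebra.TensorProduct.lmul' k q • x) := by
    intro x q
    induction q with
    | zero => exact ⟨0, by simp, by simp⟩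
    | tmul a b =>
      refine ⟨φ a ⊗ₜ (b • x), by simp, ?_⟩
      rw [conormalAction_tmul, Algebra.TensorProduct.lmul'_apply_tmul, mul_smul]
    | add q r hq hr =>
      obtain ⟨w, h1, h2⟩ := hq
      obtain ⟨w', h1', h2'⟩ := hr
      refine ⟨w + w', ?_, ?_⟩
      · rw [map_add, h1, h1', add_mul, map_add]
      · rw [map_add, h2, h2', map_add, add_smul, map_add]
  have hadd : ∀ p q : A ⊗[k] A,
      (∃ w : C ⊗[k] RingHom.ker φ,
        ((RingHom.ker φ).subtype.restrictScalars k).lTensor C w =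
          Algebra.TensorProduct.map φ (AlgHom.id k A) p ∧ conormalAction φ hφ w = 0) →
      (∃ w : C ⊗[k] RingHom.ker φ,
        ((RingHom.ker φ).subtype.restrictScalars k).lTensor C w =
          Algebra.TensorProduct.map φ (AlgHom.id k A) q ∧ conormalAction φ hφ w = 0) →
      ∃ w : C ⊗[k] RingHom.ker φ,
        ((RingHom.ker φ).subtype.restrictScalars k).lTensor C w =
          Algebra.TensorProduct.map φ (AlgHom.id k A) (p + q) ∧ conormalAction φ hφ w = 0 := by
    rintro p q ⟨w, h1, h2⟩ ⟨w', h1', h2'⟩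
    exact ⟨w + w', by rw [map_add, h1, h1', map_add], by rw [map_add, h2, h2', add_zero]⟩
  refine Submodule.mul_induction_on hp (fun r hr q hq => ?_) hadd
  rw [Algebra.TensorProduct.map_ker _ _ hφ hφ] at hr
  obtain ⟨u, hu, v, hv, rfl⟩ := Submodule.mem_sup.1 hr
  rw [add_mul]
  refine hadd _ _ ?_ ?_
  · clear hr
    revert q
    refine Submodule.span_induction ?_ ?_ ?_ ?_ hu
    · rintro _ ⟨y, hy, rfl⟩ q -
      replace hy : φ y = 0 := hy
      exact ⟨0, by simp [hy], map_zero _⟩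
    · exact fun q _ => ⟨0, by simp, map_zero _⟩
    · intro a b _ _ ha hb q hq
      rw [add_mul]
      exact hadd _ _ (ha q hq) (hb q hq)
    · intro c a _ ha q hq
      have := ha (c * q) (Ideal.mul_mem_left _ c hq)
      rwa [← mul_assoc, mul_comm a c] at this
  · clear hr
    revert q
    refine Submodule.span_induction ?_ ?_ ?_ ?_ hv
    · rintro _ ⟨y, hy, rfl⟩ q hq
      obtain ⟨w, h1, h2⟩ := key ⟨y, hy⟩ q
      refine ⟨w, by rw [h1, mul_comm]; rfl, ?_⟩
      replace hq : Algebra.TensorProduct.lmul' k q = 0 := hq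
      rw [h2, hq, zero_smul, map_zero]
    · exact fun q _ => ⟨0, by simp, map_zero _⟩
    · intro a b _ _ ha hb q hq
      rw [add_mul]
      exact hadd _ _ (ha q hq) (hb q hq)
    · intro c a _ ha q hq
      have := ha (c * q) (Ideal.mul_mem_left _ c hq)
      rwa [← mul_assoc, mul_comm a c] at this

/-- If `C` is flat over `k`, then `1 ⊗ x - x ⊗ 1 ∈ ker (φ ⊗ φ) * I_Δ` forces
`x ∈ (ker φ)²`. -/
lemma mem_ker_sq_of_mem_ideal_mul [Module.Flat k C] (φ : A →ₐ[k] C)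
    (hφ : Function.Surjective φ) (x : RingHom.ker φ)
    (h : (1 : A) ⊗ₜ[k] (x : A) - (x : A) ⊗ₜ[k] (1 : A) ∈
      RingHom.ker (Algebra.TensorProduct.map φ φ) * ideal k A) :
    (x : A) ∈ RingHom.ker φ ^ 2 := by
  obtain ⟨w, h1, h2⟩ := exists_conormalAction_eq_zero φ hφ _ h
  have hx : φ (x : A) = 0 := x.2
  have hw : w = φ 1 ⊗ₜ x := by
    refine Module.Flat.lTensor_preserves_injective_linearMap (M := C)
      ((RingHom.ker φ).subtype.restrictScalars k) Subtype.val_injective ?_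
    rw [h1]
    simp [hx]
  rw [hw, conormalAction_tmul, one_smul] at h2
  exact (Ideal.toCotangent_eq_zero _ _).1 h2

variable [Module (A ⊗[k] A) (C ⊗[k] C)]

/-- The surjection `A ⊗ A → C ⊗ C` as an `A ⊗ A`-linear map. -/
def mapLinear (φ : A →ₐ[k] C)
    (hs : ∀ (p : A ⊗[k] A) (u : C ⊗[k] C), p • u = Algebra.TensorProduct.map φ φ p * u) :
    A ⊗[k] A →ₗ[A ⊗[k] A] C ⊗[k] C where
  toFun := Algebra.TensorProduct.map φ φ
  map_add' := map_add _
  map_smul' p q := by simp [hs]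

lemma fR_tmul (φ : A →ₐ[k] C)
    (hs : ∀ (p : A ⊗[k] A) (u : C ⊗[k] C), p • u = Algebra.TensorProduct.map φ φ p * u)
    (i : ideal k A) (u : C ⊗[k] C) :
    fR k A C (i ⊗ₜ u) = Algebra.TensorProduct.map φ φ (i : A ⊗[k] A) * u := by
  rw [← hs]
  rfl

lemma exists_eq_tmul_one (φ : A →ₐ[k] C) (hφ : Function.Surjective φ)
    (hs : ∀ (p : A ⊗[k] A) (u : C ⊗[k] C), p • u = Algebra.TensorProduct.map φ φ p * u)
    (v : ideal k A ⊗[A ⊗[k] A] (C ⊗[k] C)) : ∃ i : ideal k A, v = i ⊗ₜ 1 := by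
  induction v with
  | zero => exact ⟨0, by simp⟩
  | tmul i u =>
    obtain ⟨p, rfl⟩ := Algebra.TensorProduct.map_surjective φ φ hφ hφ u
    refine ⟨p • i, ?_⟩
    rw [TensorProduct.smul_tmul, hs, mul_one]
  | add v w hv hw =>
    obtain ⟨i, rfl⟩ := hv
    obtain ⟨j, rfl⟩ := hw
    exact ⟨i + j, (TensorProduct.add_tmul _ _ _).symm⟩

lemma tmul_one_eq_zero_iff (φ : A →ₐ[k] C) (hφ : Function.Surjective φ)
    (hs : ∀ (p : A ⊗[k] A) (u : C ⊗[k] C), p • u = Algebra.TensorProduct.map φ φ p * u)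
    (i : ideal k A) :
    i ⊗ₜ[A ⊗[k] A] (1 : C ⊗[k] C) = 0 ↔
      (i : A ⊗[k] A) ∈ RingHom.ker (Algebra.TensorProduct.map φ φ) * ideal k A := by
  constructor
  · intro h
    have hex : Function.Exact (RingHom.ker (Algebra.TensorProduct.map φ φ)).subtype
        (mapLinear φ hs) := by
      intro p
      exact ⟨fun hp => ⟨⟨p, hp⟩, rfl⟩, by rintro ⟨q, rfl⟩; exact q.2⟩
    have hsurj : Function.Surjective (mapLinear φ hs) :=
      Algebra.TensorProduct.map_surjective φ φ hφ hφ
    obtain ⟨t, ht⟩ := (lTensor_exact (ideal k A) hex hsurj (i ⊗ₜ 1)).1 (by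
      rw [LinearMap.lTensor_tmul, ← h]
      congr 1
      exact map_one (Algebra.TensorProduct.map φ φ))
    have hmem : ∀ t : ideal k A ⊗[A ⊗[k] A] RingHom.ker (Algebra.TensorProduct.map φ φ),
        ((TensorProduct.rid (A ⊗[k] A) (ideal k A)
          ((RingHom.ker (Algebra.TensorProduct.map φ φ)).subtype.lTensor (ideal k A) t) :
            ideal k A) : A ⊗[k] A) ∈
          RingHom.ker (Algebra.TensorProduct.map φ φ) * ideal k A := by
      intro t
      induction t with
      | zero => simp
      | tmul j q =>
        rw [LinearMap.lTensor_tmul, TensorProduct.rid_tmul]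
        exact Ideal.mul_mem_mul q.2 j.2
      | add s t hs ht =>
        rw [map_add, map_add]
        exact add_mem hs ht
    have := hmem t
    rwa [ht, TensorProduct.rid_tmul, one_smul] at this
  · obtain ⟨i, hi⟩ := i
    intro h
    refine Submodule.mul_induction_on' (C := fun p _ => ∀ hp : p ∈ ideal k A,
      (⟨p, hp⟩ : ideal k A) ⊗ₜ[A ⊗[k] A] (1 : C ⊗[k] C) = 0) ?_ ?_ h hi
    · intro q hq j hj hp
      have : (⟨q * j, hp⟩ : ideal k A) = q • ⟨j, hj⟩ := rfl
      rw [this, TensorProduct.smul_tmul, hs, (RingHom.mem_ker).1 hq, zero_mul,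
        TensorProduct.tmul_zero]
    · intro p hp q hq h1 h2 hpq
      have hp' := Ideal.mul_le_right hp
      have hq' := Ideal.mul_le_right hq
      have : (⟨p + q, hpq⟩ : ideal k A) = ⟨p, hp'⟩ + ⟨q, hq'⟩ := rfl
      rw [this, TensorProduct.add_tmul, h1 hp', h2 hq', add_zero]

lemma deltaR_sub (φ : A →ₐ[k] C) (x y : RingHom.ker φ) :
    deltaR k A C φ (x - y) = deltaR k A C φ x - deltaR k A C φ y := by
  rw [deltaR, deltaR, deltaR, ← TensorProduct.sub_tmul]
  congr 1
  ext
  simp only [AddSubgroupClass.coe_sub, TensorProduct.tmul_sub, TensorProduct.sub_tmul]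
  ring

lemma deltaR_eq_zero_iff [Module.Flat k C] (φ : A →ₐ[k] C) (hφ : Function.Surjective φ)
    (hs : ∀ (p : A ⊗[k] A) (u : C ⊗[k] C), p • u = Algebra.TensorProduct.map φ φ p * u)
    (x : RingHom.ker φ) :
    deltaR k A C φ x = 0 ↔ (x : A) ∈ RingHom.ker φ ^ 2 := by
  rw [deltaR, tmul_one_eq_zero_iff φ hφ hs]
  refine ⟨mem_ker_sq_of_mem_ideal_mul φ hφ x, ?_⟩
  obtain ⟨x, hx⟩ := x
  intro h
  replace h : x ∈ RingHom.ker φ ^ 2 := h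
  change (1 : A) ⊗ₜ[k] x - x ⊗ₜ[k] (1 : A) ∈ _
  rw [pow_two] at h
  refine Submodule.mul_induction_on h ?_ ?_
  · intro a ha b hb
    convert add_mem
      (mul_tmul_mem_ideal_mul φ ha (one_smul_sub_smul_one_mem_ideal k b))
      (tmul_mul_mem_ideal_mul φ hb (one_smul_sub_smul_one_mem_ideal k a)) using 1
    simp only [mul_sub, Algebra.TensorProduct.tmul_mul_tmul, one_mul, mul_one]
    rw [mul_comm b a]
    ring
  · intro a b ha hb
    convert add_mem ha hb using 1
    rw [TensorProduct.tmul_add, TensorProduct.add_tmul]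
    ring

lemma exact_deltaR_fR (φ : A →ₐ[k] C) (hφ : Function.Surjective φ)
    (hs : ∀ (p : A ⊗[k] A) (u : C ⊗[k] C), p • u = Algebra.TensorProduct.map φ φ p * u) :
    Function.Exact (deltaR k A C φ) (fR k A C) := by
  intro v
  constructor
  · intro hv
    obtain ⟨i, rfl⟩ := exists_eq_tmul_one φ hφ hs v
    rw [fR_tmul φ hs, mul_one] at hv
    obtain ⟨x, hx, y, hy, h⟩ := exists_sub_mem_ideal_mul φ hφ i hv
    have hyx : y + x = 0 := by
      have h1 : Algebra.TensorProduct.lmul' k (i : A ⊗[k] A) = 0 := i.2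
      have h2 : Algebra.TensorProduct.lmul' k ((i : A ⊗[k] A) - (y ⊗ₜ 1 + 1 ⊗ₜ x)) = 0 :=
        Ideal.mul_le_right h
      rw [map_sub, h1, map_add, Algebra.TensorProduct.lmul'_apply_tmul,
        Algebra.TensorProduct.lmul'_apply_tmul] at h2
      linear_combination -h2
    obtain rfl : y = -x := eq_neg_of_add_eq_zero_left hyx
    refine ⟨⟨x, hx⟩, ?_⟩
    rw [eq_comm, ← sub_eq_zero, deltaR, ← TensorProduct.sub_tmul, tmul_one_eq_zero_iff φ hφ hs]
    convert h using 1
    change (i : A ⊗[k] A) - ((1 : A) ⊗ₜ[k] x - x ⊗ₜ[k] (1 : A)) = _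
    rw [TensorProduct.neg_tmul]
    ring
  · rintro ⟨⟨x, hx⟩, rfl⟩
    replace hx : φ x = 0 := hx
    rw [deltaR, fR_tmul φ hs]
    simp [hx]

lemma exact_fR_muR0 (φ : A →ₐ[k] C) (hφ : Function.Surjective φ)
    (hs : ∀ (p : A ⊗[k] A) (u : C ⊗[k] C), p • u = Algebra.TensorProduct.map φ φ p * u) :
    Function.Exact (fR k A C) (muR0 k C) := by
  have hcomm : ∀ p : A ⊗[k] A, muR0 k C (Algebra.TensorProduct.map φ φ p) =
      φ (Algebra.TensorProduct.lmul' k p) := by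
    intro p
    induction p with
    | zero => simp
    | tmul a b => simp
    | add p q hp hq => rw [map_add, map_add, hp, hq, map_add, map_add]
  intro u
  constructor
  · intro hu
    obtain ⟨p, rfl⟩ := Algebra.TensorProduct.map_surjective φ φ hφ hφ u
    rw [hcomm] at hu
    have hp : p - Algebra.TensorProduct.lmul' k p ⊗ₜ 1 ∈ ideal k A := by
      rw [KaehlerDifferential.ideal, RingHom.mem_ker]; simp
    refine ⟨⟨_, hp⟩ ⊗ₜ 1, ?_⟩
    rw [fR_tmul φ hs]
    simp [hu]
  · rintro ⟨v, rfl⟩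
    obtain ⟨i, rfl⟩ := exists_eq_tmul_one φ hφ hs v
    have hi : Algebra.TensorProduct.lmul' k (i : A ⊗[k] A) = 0 := i.2
    rw [fR_tmul φ hs, mul_one, hcomm, hi, map_zero]

end Row

section Ladder

open KaehlerDifferential

variable {k A R R₀ : Type} [CommRing k] [CommRing A] [CommRing R] [CommRing R₀]
  [Algebra k A] [Algebra k R] [Algebra k R₀]

lemma map_mem_ideal (f : A →ₐ[k] R) {p : A ⊗[k] A} (hp : p ∈ ideal k A) :
    Algebra.TensorProduct.map f f p ∈ ideal k R := by
  have hcomm : ∀ p : A ⊗[k] A,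
      Algebra.TensorProduct.lmul' k (Algebra.TensorProduct.map f f p) =
        f (Algebra.TensorProduct.lmul' k p) := by
    intro p
    induction p with
    | zero => simp
    | tmul a b => simp
    | add p q hp hq => rw [map_add, map_add, hp, hq, map_add, map_add]
  replace hp : Algebra.TensorProduct.lmul' k p = 0 := hp
  change Algebra.TensorProduct.lmul' k (Algebra.TensorProduct.map f f p) = 0
  rw [hcomm, hp, map_zero]

variable [Module (A ⊗[k] A) (R₀ ⊗[k] R₀)] [Module (R ⊗[k] R) (R₀ ⊗[k] R₀)]

/-- The map `I_{Δ_A} ⊗ (R₀ ⊗ R₀) → I_{Δ_R} ⊗ (R₀ ⊗ R₀)` induced by `f ⊗ f`. -/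
def ladderMap (f : A →ₐ[k] R)
    (hs : ∀ (p : A ⊗[k] A) (u : R₀ ⊗[k] R₀), p • u = Algebra.TensorProduct.map f f p • u) :
    (ideal k A ⊗[A ⊗[k] A] (R₀ ⊗[k] R₀)) →+ (ideal k R ⊗[R ⊗[k] R] (R₀ ⊗[k] R₀)) :=
  TensorProduct.liftAddHom
    { toFun := fun i =>
        { toFun := fun u =>
            (⟨Algebra.TensorProduct.map f f i, map_mem_ideal f i.2⟩ : ideal k R) ⊗ₜ u
          map_zero' := TensorProduct.tmul_zero _ _
          map_add' := TensorProduct.tmul_add _ }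
      map_zero' := by
        ext u
        have : (⟨Algebra.TensorProduct.map f f (0 : ideal k A),
            map_mem_ideal f (0 : ideal k A).2⟩ : ideal k R) = 0 :=
          Subtype.ext (map_zero (Algebra.TensorProduct.map f f))
        simp only [AddMonoidHom.coe_mk, ZeroHom.coe_mk, this, TensorProduct.zero_tmul,
          AddMonoidHom.zero_apply]
      map_add' := fun i j => by
        ext u
        simp only [AddMonoidHom.coe_mk, ZeroHom.coe_mk, AddMonoidHom.add_apply]
        rw [← TensorProduct.add_tmul]
        congr 1
        exact Subtype.ext (map_add (Algebra.TensorProduct.map f f) _ _) }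
    (fun p i u => by
      simp only [AddMonoidHom.coe_mk, ZeroHom.coe_mk]
      rw [hs, ← TensorProduct.smul_tmul]
      congr 1
      exact Subtype.ext (map_mul (Algebra.TensorProduct.map f f) _ _))

lemma ladderMap_tmul (f : A →ₐ[k] R)
    (hs : ∀ (p : A ⊗[k] A) (u : R₀ ⊗[k] R₀), p • u = Algebra.TensorProduct.map f f p • u)
    (i : ideal k A) (u : R₀ ⊗[k] R₀) :
    ladderMap f hs (i ⊗ₜ u) =
      (⟨Algebra.TensorProduct.map f f i, map_mem_ideal f i.2⟩ : ideal k R) ⊗ₜ u :=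
  rfl

lemma ladderMap_deltaA (f : A →ₐ[k] R) (π : R →ₐ[k] R₀)
    (hs : ∀ (p : A ⊗[k] A) (u : R₀ ⊗[k] R₀), p • u = Algebra.TensorProduct.map f f p • u)
    (x : RingHom.ker (π.comp f)) (hx : f (x : A) ∈ RingHom.ker π) :
    ladderMap f hs (deltaA k A R R₀ f π x) = deltaR k R R₀ π ⟨f x, hx⟩ := by
  rw [deltaA, ladderMap_tmul, deltaR]
  congr 1
  ext
  simp

lemma fR_ladderMap (f : A →ₐ[k] R)
    (hs : ∀ (p : A ⊗[k] A) (u : R₀ ⊗[k] R₀), p • u = Algebra.TensorProduct.map f f p • u)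
    (v : ideal k A ⊗[A ⊗[k] A] (R₀ ⊗[k] R₀)) :
    fR k R R₀ (ladderMap f hs v) = fA k A R₀ v := by
  induction v with
  | zero => simp
  | tmul i u =>
    rw [ladderMap_tmul]
    exact (hs i u).symm
  | add v w hv hw => rw [map_add, map_add, map_add, hv, hw]

end Ladder

set_option synthInstance.maxHeartbeats 1000000 in
theorem statement13 (πA : A →ₐ[k] R) (π : R →ₐ[k] R₀)
    (hπA : Function.Surjective πA) (hπ : Function.Surjective π)
    (hI : RingHom.ker π ^ 2 = ⊥) :
    -- `R₀ ⊗[k] R₀` as a module over `A ⊗[k] A` via `(π∘π_A) ⊗ (π∘π_A)`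
    letI : Module (A ⊗[k] A) (R₀ ⊗[k] R₀) :=
      Module.compHom _ (Algebra.TensorProduct.map (π.comp πA) (π.comp πA)).toRingHom
    -- `R₀ ⊗[k] R₀` as a module over `R ⊗[k] R` via `π ⊗ π`
    letI : Module (R ⊗[k] R) (R₀ ⊗[k] R₀) :=
      Module.compHom _ (Algebra.TensorProduct.map π π).toRingHom
    (∃ θ : ((KaehlerDifferential.ideal k A) ⊗[A ⊗[k] A] (R₀ ⊗[k] R₀)) →+
        ((KaehlerDifferential.ideal k R) ⊗[R ⊗[k] R] (R₀ ⊗[k] R₀)),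
      -- θ is induced by `π_A ⊗ π_A`, which carries `I_{Δ_A}` into `I_{Δ_R}`
      (∀ (x : KaehlerDifferential.ideal k A)
          (h : Algebra.TensorProduct.map πA πA (x : A ⊗[k] A) ∈ KaehlerDifferential.ideal k R)
          (u : R₀ ⊗[k] R₀),
          θ (x ⊗ₜ[A ⊗[k] A] u) =
            (⟨Algebra.TensorProduct.map πA πA (x : A ⊗[k] A), h⟩ :
              KaehlerDifferential.ideal k R) ⊗ₜ[R ⊗[k] R] u) ∧
      -- first square: `θ ∘ (first map of top row) = (first map of bottom row) ∘ κ`,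
      -- where `κ : J₀/J₀² → I` is induced by `x ↦ π_A x`
      (∀ (x : RingHom.ker (π.comp πA)) (hx : πA (x : A) ∈ RingHom.ker π),
          θ (deltaA k A R R₀ πA π x) = deltaR k R R₀ π ⟨πA (x : A), hx⟩) ∧
      -- second square: `(second map of bottom row) ∘ θ = id ∘ (second map of top row)`
      (∀ v, fR k R R₀ (θ v) = fA k A R₀ v)) ∧
    -- Moreover, under flatness both rows are exact with injective left-hand maps:
    (Module.Flat k A → Module.Flat k R → Module.Flat k R₀ →
      -- top row
      ((∀ x : RingHom.ker (π.comp πA),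
          deltaA k A R R₀ πA π x = 0 ↔ (x : A) ∈ RingHom.ker (π.comp πA) ^ 2) ∧
        Function.Exact (deltaA k A R R₀ πA π) (fA k A R₀) ∧
        Function.Exact (fA k A R₀) (muR0 k R₀) ∧
        Function.Surjective (muR0 k R₀) ∧
        -- bottom row
        Function.Injective (deltaR k R R₀ π) ∧
        Function.Exact (deltaR k R R₀ π) (fR k R R₀) ∧
        Function.Exact (fR k R R₀) (muR0 k R₀))) := by
  let instA : Module (A ⊗[k] A) (R₀ ⊗[k] R₀) :=
    Module.compHom _ (Algebra.TensorProduct.map (π.comp πA) (π.comp πA)).toRingHom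
  let instR : Module (R ⊗[k] R) (R₀ ⊗[k] R₀) :=
    Module.compHom _ (Algebra.TensorProduct.map π π).toRingHom
  have hsA : ∀ (p : A ⊗[k] A) (u : R₀ ⊗[k] R₀),
      p • u = Algebra.TensorProduct.map (π.comp πA) (π.comp πA) p * u := fun _ _ => rfl
  have hsR : ∀ (p : R ⊗[k] R) (u : R₀ ⊗[k] R₀),
      p • u = Algebra.TensorProduct.map π π p * u := fun _ _ => rfl
  have hsAR : ∀ (p : A ⊗[k] A) (u : R₀ ⊗[k] R₀),
      p • u = Algebra.TensorProduct.map πA πA p • u := by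
    intro p u
    rw [hsA, hsR, Algebra.TensorProduct.map_comp, AlgHom.comp_apply]
  have hφ : Function.Surjective (π.comp πA) := hπ.comp hπA
  refine ⟨⟨ladderMap πA hsAR, fun _ _ _ => rfl, ladderMap_deltaA πA π hsAR,
    fR_ladderMap πA hsAR⟩, fun _ _ _ => ⟨deltaR_eq_zero_iff (π.comp πA) hφ hsA,
      exact_deltaR_fR (π.comp πA) hφ hsA, exact_fR_muR0 (π.comp πA) hφ hsA,
      fun c => ⟨c ⊗ₜ 1, by simp⟩, fun x y hxy => ?_, exact_deltaR_fR π hπ hsR,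
      exact_fR_muR0 π hπ hsR⟩⟩
  have h := (deltaR_eq_zero_iff π hπ hsR (x - y)).1 (by rw [deltaR_sub, hxy, sub_self])
  rw [hI, Ideal.mem_bot] at h
  exact sub_eq_zero.1 (Subtype.ext h)

end
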